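/- Let q ≥ 4 be a prime power and let F be a finite field with q elements. Then there do not exist non-identity elements x, y in PSL₂(F) = SL₂(F)/Z(SL₂(F)) such that every element of PSL₂(F) is a product u·v with u ∈ C(x) and v ∈ C(y) (centralizers taken in PSL₂(F)); likewise there do not exist non-identity elements x, y in PGL₂(F) = GL₂(F)/Z(GL₂(F)) such that every element of PGL₂(F) is a product u·v with u ∈ C(x) and v ∈ C(y) (centralizers taken in PGL₂(F)). -/

import Mathlib

open Matrix in
/-- A nonscalar matrix has an `SL₂`-conjugate with nonzero lower-left entry. -/
theorem aux_conj {F : Type*} [Field F] (x : Matrix (Fin 2) (Fin 2) F)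
    (hx : ¬ (x 0 1 = 0 ∧ x 1 0 = 0 ∧ x 0 0 = x 1 1)) :
    ∃ g : SpecialLinearGroup (Fin 2) F,
      ((g : Matrix (Fin 2) (Fin 2) F) * x * ((g⁻¹ : SpecialLinearGroup (Fin 2) F) :
        Matrix (Fin 2) (Fin 2) F)) 1 0 ≠ 0 := by
  by_cases h1 : x 1 0 = 0
  · by_cases h2 : x 0 1 = 0
    · have h3 : x 0 0 ≠ x 1 1 := fun h => hx ⟨h2, h1, h⟩
      refine ⟨⟨!![1, 0; 1, 1], by simp [det_fin_two]⟩, ?_⟩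
      change (!![1, 0; 1, 1] * x * adjugate !![1, 0; 1, 1] : Matrix (Fin 2) (Fin 2) F) 1 0 ≠ 0
      simp [adjugate_fin_two_of, Matrix.mul_apply, Fin.sum_univ_two, vecMul, dotProduct, h1, h2]
      intro h
      apply h3
      linear_combination h
    · refine ⟨⟨!![0, 1; -1, 0], by simp [det_fin_two]⟩, ?_⟩
      change (!![0, 1; -1, 0] * x * adjugate !![0, 1; -1, 0] : Matrix (Fin 2) (Fin 2) F) 1 0 ≠ 0
      simp [adjugate_fin_two_of, Matrix.mul_apply, Fin.sum_univ_two, vecMul, dotProduct, h1, h2]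
  · exact ⟨1, by simpa using h1⟩

/-- The square of a genuine quadratic is not constant on a field with at least four elements. -/
theorem aux_quad {F : Type*} [Field F] [Fintype F] (h4 : 4 ≤ Fintype.card F) (a b c d : F)
    (ha : a ≠ 0) (h : ∀ t : F, (a * t ^ 2 + b * t + c) ^ 2 = d) : False := by
  classical
  by_cases h2 : (2 : F) = 0
  · -- characteristic two
    have hc : ∀ t : F, t * (a * t + b) = 0 := by
      intro t
      have := h t
      have h0 := h 0
      have h5 : (a * t ^ 2 + b * t) ^ 2 = 0 := by
        linear_combination this - h0 - (a * t ^ 2 + b * t) * c * h2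
      have h6 := pow_eq_zero_iff (two_ne_zero) |>.1 h5
      linear_combination h6
    have hs : (Finset.univ : Finset F) ⊆ {0, -b / a} := by
      intro t _
      rcases mul_eq_zero.1 (hc t) with h | h
      · simp [h]
      · simp only [Finset.mem_insert, Finset.mem_singleton]
        right
        field_simp
        linear_combination h
    have := (Finset.card_le_card hs).trans Finset.card_le_two
    rw [Finset.card_univ] at this
    omega
  · have h5 : 5 ≤ Fintype.card F := by
      by_contra hlt
      have h44 : Fintype.card F = 4 := by omega
      have : ((Fintype.card F : ℕ) : F) = 0 := by simp
      rw [h44] at this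
      apply h2
      have h22 : (2 : F) * 2 = 0 := by
        rw [← this]; push_cast; norm_num
      simpa using h22
    let P : Polynomial F := (Polynomial.C a * Polynomial.X ^ 2 + Polynomial.C b * Polynomial.X
      + Polynomial.C c)
    have hP : P.natDegree = 2 := Polynomial.natDegree_quadratic ha
    have hPP : (P ^ 2 - Polynomial.C d).natDegree = 4 := by
      rw [Polynomial.natDegree_sub_C, Polynomial.natDegree_pow, hP]
    have hne : P ^ 2 - Polynomial.C d ≠ 0 := by
      intro h0
      rw [h0] at hPP
      simp at hPP
    have := Polynomial.card_le_degree_of_subset_roots (p := P ^ 2 - Polynomial.C d)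
      (Z := Finset.univ) (by
        intro t _
        rw [Polynomial.mem_roots hne, Polynomial.IsRoot]
        simp [P, h t])
    rw [hPP, Finset.card_univ] at this
    omega

open Matrix in
/-- Trace squares of products with conjugates are non-constant. -/
theorem aux_trace {F : Type*} [Field F] [Fintype F] (h4 : 4 ≤ Fintype.card F)
    (x y : Matrix (Fin 2) (Fin 2) F) (d : F)
    (hx : ¬ (x 0 1 = 0 ∧ x 1 0 = 0 ∧ x 0 0 = x 1 1))
    (hy : ¬ (y 0 1 = 0 ∧ y 1 0 = 0 ∧ y 0 0 = y 1 1))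
    (h : ∀ k : SpecialLinearGroup (Fin 2) F,
      (x * (k : Matrix (Fin 2) (Fin 2) F) * y * ((k⁻¹ : SpecialLinearGroup (Fin 2) F) :
        Matrix (Fin 2) (Fin 2) F)).trace ^ 2 = d) : False := by
  obtain ⟨g, hg⟩ := aux_conj x hx
  obtain ⟨k, hk⟩ := aux_conj y hy
  set x' := (g : Matrix (Fin 2) (Fin 2) F) * x * ((g⁻¹ : SpecialLinearGroup (Fin 2) F) :
        Matrix (Fin 2) (Fin 2) F) with hx'
  set y' := (k : Matrix (Fin 2) (Fin 2) F) * y * ((k⁻¹ : SpecialLinearGroup (Fin 2) F) :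
        Matrix (Fin 2) (Fin 2) F) with hy'
  refine aux_quad h4 (-(x' 1 0 * y' 1 0))
    (x' 0 0 * y' 1 0 + x' 1 0 * (y' 1 1 - y' 0 0) - x' 1 1 * y' 1 0)
    (x' 0 0 * y' 0 0 + x' 0 1 * y' 1 0 + x' 1 0 * y' 0 1 + x' 1 1 * y' 1 1) d
    (neg_ne_zero.2 (mul_ne_zero hg hk)) ?_
  intro t
  let u : SpecialLinearGroup (Fin 2) F := ⟨!![1, t; 0, 1], by simp [det_fin_two]⟩
  have key := h (g⁻¹ * u * k)
  have e : (x * ((g⁻¹ * u * k : SpecialLinearGroup (Fin 2) F) : Matrix (Fin 2) (Fin 2) F) * y *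
      (((g⁻¹ * u * k)⁻¹ : SpecialLinearGroup (Fin 2) F) : Matrix (Fin 2) (Fin 2) F)).trace
      = (x' * (u : Matrix (Fin 2) (Fin 2) F) * y' * ((u⁻¹ : SpecialLinearGroup (Fin 2) F) :
        Matrix (Fin 2) (Fin 2) F)).trace := by
    rw [hx', hy', _root_.mul_inv_rev, _root_.mul_inv_rev, inv_inv]
    simp only [Matrix.SpecialLinearGroup.coe_mul]
    rw [show (g : Matrix (Fin 2) (Fin 2) F) * x * ((g⁻¹ : SpecialLinearGroup (Fin 2) F) :
        Matrix (Fin 2) (Fin 2) F) * (u : Matrix (Fin 2) (Fin 2) F) *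
        ((k : Matrix (Fin 2) (Fin 2) F) * y * ((k⁻¹ : SpecialLinearGroup (Fin 2) F) :
        Matrix (Fin 2) (Fin 2) F)) * ((u⁻¹ : SpecialLinearGroup (Fin 2) F) :
        Matrix (Fin 2) (Fin 2) F) = (g : Matrix (Fin 2) (Fin 2) F) * (x *
        ((g⁻¹ : SpecialLinearGroup (Fin 2) F) :
        Matrix (Fin 2) (Fin 2) F) * (u : Matrix (Fin 2) (Fin 2) F) *
        ((k : Matrix (Fin 2) (Fin 2) F) * y * ((k⁻¹ : SpecialLinearGroup (Fin 2) F) :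
        Matrix (Fin 2) (Fin 2) F)) * ((u⁻¹ : SpecialLinearGroup (Fin 2) F) :
        Matrix (Fin 2) (Fin 2) F)) by simp only [mul_assoc],
        Matrix.trace_mul_comm (g : Matrix (Fin 2) (Fin 2) F)]
    simp only [mul_assoc]
  rw [e] at key
  rw [← key]
  congr 1
  clear_value x' y'
  change _ = (x' * !![1, t; 0, 1] * y' * adjugate !![1, t; 0, 1]).trace
  simp [adjugate_fin_two_of, Matrix.mul_apply, Fin.sum_univ_two,
    Matrix.trace_fin_two]
  ring

open Matrix in
/-- The common argument for `SL₂` and `GL₂`. -/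
theorem aux_main {F : Type*} [Field F] [Fintype F] (h4 : 4 ≤ Fintype.card F)
    {G : Type*} [Group G] (φ : G →* Matrix (Fin 2) (Fin 2) F) (hφ : Function.Injective φ)
    (ι : SpecialLinearGroup (Fin 2) F →* G)
    (hι : ∀ s, φ (ι s) = (s : Matrix (Fin 2) (Fin 2) F)) :
    ¬ ∃ x y : G ⧸ Subgroup.center G, x ≠ 1 ∧ y ≠ 1 ∧
        ∀ g : G ⧸ Subgroup.center G,
          ∃ u ∈ Subgroup.centralizer {x}, ∃ v ∈ Subgroup.centralizer {y}, g = u * v := by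
  rintro ⟨X, Y, hX, hY, h⟩
  obtain ⟨x, rfl⟩ := QuotientGroup.mk_surjective X
  obtain ⟨y, rfl⟩ := QuotientGroup.mk_surjective Y
  have hns : ∀ x : G, (x : G ⧸ Subgroup.center G) ≠ 1 →
      ¬ (φ x 0 1 = 0 ∧ φ x 1 0 = 0 ∧ φ x 0 0 = φ x 1 1) := by
    rintro x hx ⟨h1, h2, h3⟩
    apply hx
    rw [QuotientGroup.eq_one_iff, Subgroup.mem_center_iff]
    intro g
    apply hφ
    rw [map_mul, map_mul]
    ext i j
    fin_cases i <;> fin_cases j <;>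
      simp [Matrix.mul_apply, Fin.sum_univ_two, h1, h2, h3, mul_comm]
  have hcen : ∀ z ∈ Subgroup.center G, ∃ c : F, φ z = c • (1 : Matrix (Fin 2) (Fin 2) F) := by
    intro z hz
    rw [Subgroup.mem_center_iff] at hz
    let u : SpecialLinearGroup (Fin 2) F := ⟨!![1, 1; 0, 1], by simp [det_fin_two]⟩
    let w : SpecialLinearGroup (Fin 2) F := ⟨!![1, 0; 1, 1], by simp [det_fin_two]⟩
    have hu := congrArg φ (hz (ι u))
    have hw := congrArg φ (hz (ι w))
    rw [map_mul, map_mul, hι] at hu hw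
    have e1 := congrFun (congrFun hu 0) 0
    have e2 := congrFun (congrFun hu 0) 1
    have e3 := congrFun (congrFun hw 0) 0
    simp [u, w, Matrix.mul_apply, Fin.sum_univ_two] at e1 e2 e3
    refine ⟨φ z 0 0, ?_⟩
    ext i j
    fin_cases i <;> fin_cases j <;> simp
    · exact e3
    · exact e1
    · linear_combination e2
  have hdet : ∀ g : G, (φ g).det * (φ g⁻¹).det = 1 := by
    intro g
    rw [← Matrix.det_mul, ← map_mul]
    simp
  refine aux_trace h4 (φ x) (φ y) ((φ (x * y)).trace ^ 2) (hns x hX) (hns y hY) ?_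
  intro k
  obtain ⟨u, hu, v, hv, huv⟩ := h (ι k : G)
  obtain ⟨U, rfl⟩ := QuotientGroup.mk_surjective u
  rw [Subgroup.mem_centralizer_singleton_iff] at hu hv
  have hq : ((x * ι k * y * (ι k)⁻¹ : G) : G ⧸ Subgroup.center G) =
      ((U * (x * y) * U⁻¹ : G) : G ⧸ Subgroup.center G) := by
    simp only [QuotientGroup.mk_mul, QuotientGroup.mk_inv]
    rw [huv, _root_.mul_inv_rev]
    have hu' : (x : G ⧸ Subgroup.center G) * U = U * x := by first | exact hu | exact hu.symm
    have hv' : v * (y : G ⧸ Subgroup.center G) = y * v := by first | exact hv | exact hv.symm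
    calc _ = ((x : G ⧸ Subgroup.center G) * U) * (v * y) * (v⁻¹ * (U : G ⧸ Subgroup.center G)⁻¹) := by
          group
      _ = _ := by rw [hu', hv']; group
  have hz := QuotientGroup.eq.1 hq.symm
  obtain ⟨c, hc⟩ := hcen _ hz
  have e : x * ι k * y * (ι k)⁻¹ = U * (x * y) * U⁻¹ *
      ((U * (x * y) * U⁻¹)⁻¹ * (x * ι k * y * (ι k)⁻¹)) := by group
  have e' := congrArg φ e
  rw [map_mul φ (U * (x * y) * U⁻¹), hc] at e'
  have hlhs : φ (x * ι k * y * (ι k)⁻¹) = φ x * (k : Matrix (Fin 2) (Fin 2) F) * φ y *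
      ((k⁻¹ : SpecialLinearGroup (Fin 2) F) : Matrix (Fin 2) (Fin 2) F) := by
    rw [← map_inv, map_mul, map_mul, map_mul, hι, hι]
  have hc2 : c ^ 2 = 1 := by
    have hd := congrArg Matrix.det e'
    rw [hlhs] at hd
    simp only [map_mul, Matrix.det_mul, Matrix.SpecialLinearGroup.det_coe, Matrix.det_smul,
      Matrix.det_one, Fintype.card_fin] at hd
    have hxx := hdet x
    have hyy := hdet y
    have hUU := hdet U
    have hne : (φ x).det * (φ y).det ≠ 0 :=
      mul_ne_zero (left_ne_zero_of_mul_eq_one hxx) (left_ne_zero_of_mul_eq_one hyy)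
    apply mul_left_cancel₀ hne
    linear_combination -hd - (φ x).det * (φ y).det * c ^ 2 * hUU
  rw [← hlhs, e']
  have ht : (φ (U * (x * y) * U⁻¹)).trace = (φ (x * y)).trace := by
    rw [map_mul, Matrix.trace_mul_comm, ← map_mul]
    congr 2
    group
  rw [mul_smul_comm, mul_one, Matrix.trace_smul, ht, smul_eq_mul, mul_pow, hc2, one_mul]


/-- For a prime power `q ≥ 4`, neither `PSL₂(q)` nor `PGL₂(q)` admits a factorization
`G = C_G(x) C_G(y)` with `x, y` non-identity elements. -/
theorem stmt_12 (q : ℕ) (hq : IsPrimePow q) (hq4 : 4 ≤ q)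
    (F : Type*) [Field F] [Fintype F] (hF : Fintype.card F = q) :
    (¬ ∃ x y : Matrix.SpecialLinearGroup (Fin 2) F ⧸
        Subgroup.center (Matrix.SpecialLinearGroup (Fin 2) F),
      x ≠ 1 ∧ y ≠ 1 ∧
        ∀ g : Matrix.SpecialLinearGroup (Fin 2) F ⧸
            Subgroup.center (Matrix.SpecialLinearGroup (Fin 2) F),
          ∃ u ∈ Subgroup.centralizer {x}, ∃ v ∈ Subgroup.centralizer {y}, g = u * v) ∧
    (¬ ∃ x y : Matrix.GeneralLinearGroup (Fin 2) F ⧸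
        Subgroup.center (Matrix.GeneralLinearGroup (Fin 2) F),
      x ≠ 1 ∧ y ≠ 1 ∧
        ∀ g : Matrix.GeneralLinearGroup (Fin 2) F ⧸
            Subgroup.center (Matrix.GeneralLinearGroup (Fin 2) F),
          ∃ u ∈ Subgroup.centralizer {x}, ∃ v ∈ Subgroup.centralizer {y}, g = u * v) := by
  have h4 : 4 ≤ Fintype.card F := hF ▸ hq4
  constructor
  · exact aux_main h4
      { toFun := fun A : Matrix.SpecialLinearGroup (Fin 2) F => (A : Matrix (Fin 2) (Fin 2) F)
        map_one' := rfl
        map_mul' := fun _ _ => rfl }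
      (fun _ _ h => Subtype.ext h) (MonoidHom.id _) (fun _ => rfl)
  · exact aux_main h4 (Units.coeHom (Matrix (Fin 2) (Fin 2) F))
      (fun _ _ h => Units.ext h) Matrix.SpecialLinearGroup.toGL (fun _ => rfl)
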